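/- Let H be a complex Hilbert space and let A = C + T be a compact operator, where C is a non-negative compact operator such that lim_{n→∞} s_n(C)/L(n) = a for some slowly varying function L and some constant 0 < a < ∞, and T belongs to the Schatten–von Neumann class S_q for some q > 0. Then the adjoint operator A* cannot be a Volterra operator; that is, A* has at least one nonzero eigenvalue. -/

import Mathlib

open Filter Topology

/-- The `n`-th singular value (`s`-number) of an operator on a Hilbert space,
indexed so that `sNum T 1 = ‖T‖` is the first singular value: `sNum T n` is the
distance from `T` to the operators of rank `< n`. -/
noncomputable def sNum {H : Type*} [NormedAddCommGroup H] [InnerProductSpace ℂ H]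
    (T : H →L[ℂ] H) (n : ℕ) : ℝ :=
  ⨅ F : {F : H →L[ℂ] H // Module.rank ℂ (LinearMap.range (F : H →ₗ[ℂ] H)) < (n : Cardinal)},
    ‖T - (F : H →L[ℂ] H)‖

/-- `L : [b, ∞) → ℝ` (with `b > 0`) is slowly varying if it is positive,
continuously differentiable, and `x * L' x / L x → 0` as `x → ∞`. -/
structure SlowlyVarying (b : ℝ) (L : ℝ → ℝ) : Prop where
  b_pos : 0 < b
  pos : ∀ x, b ≤ x → 0 < L x
  contDiff : ContDiffOn ℝ 1 L (Set.Ici b)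
  slow : Tendsto (fun x : ℝ => x * deriv L x / L x) atTop (𝓝 0)


section FinDim
open scoped InnerProductSpace

variable {V : Type*} [NormedAddCommGroup V] [InnerProductSpace ℂ V] [FiniteDimensional ℂ V]
  {ι : Type*} [Fintype ι]

set_option linter.unusedSectionVars false in
theorem onb_jensen (u v : OrthonormalBasis ι ℂ V) (x : ι → ℝ) (p : ℕ) :
    ∑ j, |∑ i, x i * ‖inner ℂ (u i) (v j)‖ ^ 2| ^ p ≤ ∑ i, |x i| ^ p := by
  have h1 : ∀ j, |∑ i, x i * ‖inner ℂ (u i) (v j)‖ ^ 2| ^ p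
      ≤ ∑ i, ‖inner ℂ (u i) (v j)‖ ^ 2 * |x i| ^ p := by
    intro j
    have hs : ∑ i, ‖inner ℂ (u i) (v j)‖ ^ 2 = 1 := by
      rw [u.sum_sq_norm_inner_right]; simp
    refine le_trans ?_ (Real.pow_arith_mean_le_arith_mean_pow Finset.univ
      (fun i => ‖inner ℂ (u i) (v j)‖ ^ 2) (fun i => |x i|) (fun i _ => by positivity) hs
      (fun i _ => abs_nonneg _) p)
    refine pow_le_pow_left₀ (abs_nonneg _) ((Finset.abs_sum_le_sum_abs _ _).trans ?_) p
    refine Finset.sum_le_sum fun i _ => ?_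
    rw [abs_mul, mul_comm, abs_of_nonneg (by positivity : (0:ℝ) ≤ ‖inner ℂ (u i) (v j)‖ ^ 2)]
  refine (Finset.sum_le_sum fun j _ => h1 j).trans ?_
  rw [Finset.sum_comm]
  refine Finset.sum_le_sum fun i _ => ?_
  rw [← Finset.sum_mul, v.sum_sq_norm_inner_left]; simp

theorem exists_diag {n : ℕ} (hn : Module.finrank ℂ V = n) (X : V →ₗ[ℂ] V) (hX : X.IsSymmetric) :
    ∃ (u : OrthonormalBasis (Fin n) ℂ V) (x : Fin n → ℝ), (∀ i, X (u i) = (x i : ℂ) • u i) ∧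
      (∀ z, (inner ℂ z (X z)).re = ∑ i, x i * ‖inner ℂ (u i) z‖ ^ 2) ∧
      (∀ z, ‖X z‖ ^ 2 = ∑ i, (x i) ^ 2 * ‖inner ℂ (u i) z‖ ^ 2) := by
  set u := hX.eigenvectorBasis hn
  set x := hX.eigenvalues hn
  have h1 : ∀ i, X (u i) = (x i : ℂ) • u i := fun i => hX.apply_eigenvectorBasis hn i
  have h2 : ∀ i z, inner ℂ (u i) (X z) = (x i : ℂ) * inner ℂ (u i) z := by
    intro i z
    rw [← hX (u i) z, h1, inner_smul_left]; simp
  refine ⟨u, x, h1, ?_, ?_⟩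
  · intro z
    rw [← u.sum_inner_mul_inner, Complex.re_sum]
    refine Finset.sum_congr rfl fun i _ => ?_
    rw [h2, mul_left_comm, ← inner_conj_symm z (u i), mul_comm (starRingEnd ℂ _), Complex.mul_conj,
      Complex.normSq_eq_norm_sq, ← Complex.ofReal_mul, Complex.ofReal_re]
  · intro z
    rw [← u.sum_sq_norm_inner_right]
    refine Finset.sum_congr rfl fun i _ => ?_
    rw [h2, norm_mul, mul_pow]; simp

/-- real and imaginary parts. -/
theorem exists_re_im (N : V →ₗ[ℂ] V) : ∃ R J : V →ₗ[ℂ] V, R.IsSymmetric ∧ J.IsSymmetric ∧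
    (∀ z, (inner ℂ z (N z)).re = (inner ℂ z (R z)).re) ∧
    (∀ z, (inner ℂ z (N z)).im = (inner ℂ z (J z)).re) ∧
    (∀ z, (inner ℂ z ((N ^ 2) z)).re = ‖R z‖ ^ 2 - ‖J z‖ ^ 2) ∧
    (∀ z, |(inner ℂ z ((N ^ 2) z)).im| ≤ 2 * (‖R z‖ * ‖J z‖)) := by
  set R : V →ₗ[ℂ] V := (1/2 : ℂ) • (N + LinearMap.adjoint N) with hR
  set J : V →ₗ[ℂ] V := (-Complex.I/2 : ℂ) • (N - LinearMap.adjoint N) with hJ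
  have hRs : R.IsSymmetric := by
    intro x y
    simp [hR, inner_smul_left, inner_smul_right, inner_add_left, inner_add_right,
      LinearMap.adjoint_inner_left, LinearMap.adjoint_inner_right, Complex.conj_ofNat]
    ring
  have hJs : J.IsSymmetric := by
    intro x y
    simp [hJ, inner_smul_left, inner_smul_right, inner_sub_left, inner_sub_right,
      LinearMap.adjoint_inner_left, LinearMap.adjoint_inner_right, Complex.conj_ofNat]
    ring
  have hI : Complex.I * (-Complex.I / 2) = 1/2 := by
    rw [mul_div_assoc', mul_neg, Complex.I_mul_I]; norm_num
  have hN : ∀ z, N z = R z + Complex.I • J z := by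
    intro z
    simp only [hR, hJ, LinearMap.smul_apply, LinearMap.add_apply, LinearMap.sub_apply, smul_smul, hI]
    module
  have hN' : ∀ z, LinearMap.adjoint N z = R z - Complex.I • J z := by
    intro z
    simp only [hR, hJ, LinearMap.smul_apply, LinearMap.add_apply, LinearMap.sub_apply, smul_smul, hI]
    module
  have key : ∀ z, inner ℂ z ((N ^ 2) z) = ((‖R z‖ ^ 2 - ‖J z‖ ^ 2 : ℝ) : ℂ)
      + Complex.I * ((2 * (inner ℂ (R z) (J z)).re : ℝ) : ℂ) := by
    intro z
    rw [pow_two, Module.End.mul_apply, ← LinearMap.adjoint_inner_left, hN', hN]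
    rw [inner_sub_left, inner_add_right, inner_add_right, inner_smul_left, inner_smul_left,
      inner_smul_right, inner_smul_right, inner_self_eq_norm_sq_to_K, inner_self_eq_norm_sq_to_K,
      ← inner_conj_symm (J z) (R z)]
    generalize inner ℂ (R z) (J z) = c
    apply Complex.ext
    · simp [pow_two]; ring
    · simp [pow_two]; ring
  have hRr : ∀ z, (inner ℂ z (R z)).im = 0 := fun z => by
    have := hRs.im_inner_self_apply z; simpa [← hRs z z] using this
  have hJr : ∀ z, (inner ℂ z (J z)).im = 0 := fun z => by
    have := hJs.im_inner_self_apply z; simpa [← hJs z z] using this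
  refine ⟨R, J, hRs, hJs, ?_, ?_, ?_, ?_⟩
  · intro z; rw [hN, inner_add_right, inner_smul_right]; simp [hJr]
  · intro z; rw [hN, inner_add_right, inner_smul_right]; simp [hRr]
  · intro z; rw [key]; simp [← Complex.ofReal_pow]
  · intro z; rw [key]
    have := (Complex.abs_re_le_norm _).trans (norm_inner_le_norm (𝕜 := ℂ) (R z) (J z))
    simp [abs_mul]; norm_cast; simp; linarith

end FinDim

universe u

theorem macaev_fin (k : ℕ) : ∃ K : ℝ, 0 ≤ K ∧ ∀ (V : Type u) [NormedAddCommGroup V]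
    [InnerProductSpace ℂ V] [FiniteDimensional ℂ V] (n : ℕ) (_ : Module.finrank ℂ V = n)
    (N : V →ₗ[ℂ] V) (_ : IsNilpotent N) (M : ℝ)
    (_ : ∀ z : OrthonormalBasis (Fin n) ℂ V, ∑ i, |(inner ℂ (z i) (N (z i))).im| ^ (2 ^ (k + 1)) ≤ M)
    (v : OrthonormalBasis (Fin n) ℂ V),
    ∑ i, |(inner ℂ (v i) (N (v i))).re| ^ (2 ^ (k + 1)) ≤ K * M := by
  induction k with
  | zero =>
    refine ⟨1, zero_le_one, ?_⟩
    intro V _ _ _ n hn N hN M hM v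
    obtain ⟨R, J, hR, hJ, hre, him, hre2, him2⟩ := exists_re_im N
    obtain ⟨w, y, hw, hy1, hy2⟩ := exists_diag hn J hJ
    have htr : ∑ i, (inner ℂ (v i) ((N ^ 2) (v i))).re = 0 := by
      have h := LinearMap.isNilpotent_trace_of_isNilpotent (hN.pow_of_pos (n := 2) two_ne_zero)
      rw [isNilpotent_iff_eq_zero, LinearMap.trace_eq_sum_inner _ v] at h
      rw [← Complex.re_sum, h]; simp
    simp only [hre2, Finset.sum_sub_distrib] at htr
    have hJv : ∑ i, ‖J (v i)‖ ^ 2 ≤ ∑ i, |y i ^ 2| ^ 1 := by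
      refine le_trans (le_of_eq ?_) (onb_jensen w v (fun i => y i ^ 2) 1)
      refine Finset.sum_congr rfl fun j _ => ?_
      rw [← hy2, pow_one, abs_of_nonneg (by positivity)]
    have hyM : ∑ i, |y i ^ 2| ^ 1 ≤ M := by
      refine le_trans (le_of_eq ?_) (hM w)
      refine Finset.sum_congr rfl fun j _ => ?_
      rw [him, hw, inner_smul_right]; simp
    have hRv : ∑ i, |(inner ℂ (v i) (N (v i))).re| ^ (2 ^ (0 + 1)) ≤ ∑ i, ‖R (v i)‖ ^ 2 := by
      refine Finset.sum_le_sum fun i _ => ?_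
      rw [hre]
      have h1 := (Complex.abs_re_le_norm _).trans (norm_inner_le_norm (𝕜 := ℂ) (v i) (R (v i)))
      simp only [OrthonormalBasis.norm_eq_one, one_mul] at h1
      simpa using pow_le_pow_left₀ (abs_nonneg _) h1 2
    linarith
  | succ k ih =>
    obtain ⟨K, hK0, ih⟩ := ih
    set p : ℕ := 2 ^ (k + 1) with hp
    set a : ℝ := 2 ^ p * K * 2 ^ p with ha
    set b : ℝ := 2 ^ p with hb
    have ha0 : 0 ≤ a := by positivity
    have hb0 : 0 ≤ b := by positivity
    refine ⟨(a + b + 1) ^ 2, by positivity, ?_⟩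
    intro V _ _ _ n hn N hN M hM v
    have hpp : 2 ^ (k + 1 + 1) = 2 * p := by rw [hp]; ring
    rw [hpp] at hM ⊢
    obtain ⟨R, J, hR, hJ, hre, him, hre2, him2⟩ := exists_re_im N
    obtain ⟨w, y, hw, hy1, hy2⟩ := exists_diag hn J hJ
    obtain ⟨u, x, hu, hx1, hx2⟩ := exists_diag hn R hR
    set ρ : ℝ := ∑ i, |x i ^ 2| ^ p with hρ
    have hρ0 : 0 ≤ ρ := Finset.sum_nonneg fun i _ => by positivity
    have hRz : ∀ z : OrthonormalBasis (Fin n) ℂ V, ∑ i, (‖R (z i)‖ ^ 2) ^ p ≤ ρ := by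
      intro z
      refine le_trans (le_of_eq ?_) (onb_jensen u z (fun i => x i ^ 2) p)
      refine Finset.sum_congr rfl fun j _ => ?_
      rw [← hx2, abs_of_nonneg (by positivity)]
    have hyM : ∑ i, |y i ^ 2| ^ p ≤ M := by
      refine le_trans (le_of_eq ?_) (hM w)
      refine Finset.sum_congr rfl fun j _ => ?_
      rw [him, hw, inner_smul_right, pow_mul]; simp
    have hM0 : 0 ≤ M := le_trans (Finset.sum_nonneg fun i _ => by positivity) hyM
    have hJz : ∀ z : OrthonormalBasis (Fin n) ℂ V, ∑ i, (‖J (z i)‖ ^ 2) ^ p ≤ M := by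
      intro z
      refine le_trans (le_of_eq ?_) ((onb_jensen w z (fun i => y i ^ 2) p).trans hyM)
      refine Finset.sum_congr rfl fun j _ => ?_
      rw [← hy2, abs_of_nonneg (by positivity)]
    have hSz : ∀ z : OrthonormalBasis (Fin n) ℂ V,
        ∑ i, |(inner ℂ (z i) ((N ^ 2) (z i))).im| ^ p ≤ 2 ^ p * (√ρ * √M) := by
      intro z
      calc ∑ i, |(inner ℂ (z i) ((N ^ 2) (z i))).im| ^ p
          ≤ ∑ i, 2 ^ p * (‖R (z i)‖ ^ p * ‖J (z i)‖ ^ p) := by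
            refine Finset.sum_le_sum fun i _ => ?_
            rw [← mul_pow, ← mul_pow]
            exact pow_le_pow_left₀ (abs_nonneg _) (him2 _) p
        _ = 2 ^ p * ∑ i, ‖R (z i)‖ ^ p * ‖J (z i)‖ ^ p := by rw [Finset.mul_sum]
        _ ≤ _ := by
            gcongr
            refine (Real.sum_mul_le_sqrt_mul_sqrt _ _ _).trans ?_
            gcongr
            · refine le_trans (le_of_eq ?_) (hRz z)
              exact Finset.sum_congr rfl fun i _ => by ring
            · refine le_trans (le_of_eq ?_) (hJz z)
              exact Finset.sum_congr rfl fun i _ => by ring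
    have hD := ih V n hn (N ^ 2) (hN.pow_of_pos two_ne_zero) _ hSz u
    have hmain : ρ ≤ 2 ^ p * (K * (2 ^ p * (√ρ * √M)) + M) := by
      calc ρ ≤ ∑ i, 2 ^ p * (|(inner ℂ (u i) ((N ^ 2) (u i))).re| ^ p + (‖J (u i)‖ ^ 2) ^ p) := by
            refine Finset.sum_le_sum fun i _ => ?_
            have h1 : |x i ^ 2| ≤ |(inner ℂ (u i) ((N ^ 2) (u i))).re| + ‖J (u i)‖ ^ 2 := by
              have h2 : ‖R (u i)‖ ^ 2 = x i ^ 2 := by rw [hu, norm_smul]; simp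
              have h3 := le_abs_self ((inner ℂ (u i) ((N ^ 2) (u i))).re)
              rw [abs_of_nonneg (sq_nonneg _), ← h2]
              rw [hre2] at h3 ⊢; linarith
            refine (pow_le_pow_left₀ (abs_nonneg _) h1 p).trans ?_
            refine (add_pow_le (abs_nonneg _) (by positivity) p).trans ?_
            gcongr
            · norm_num
            · omega
        _ = 2 ^ p * (∑ i, |(inner ℂ (u i) ((N ^ 2) (u i))).re| ^ p + ∑ i, (‖J (u i)‖ ^ 2) ^ p) := by
            rw [← Finset.mul_sum, Finset.sum_add_distrib]
        _ ≤ _ := by gcongr; exact hJz u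
    have hfin : ρ ≤ (a + b + 1) ^ 2 * M := by
      have e1 : √ρ ^ 2 = ρ := Real.sq_sqrt hρ0
      have e2 : √M ^ 2 = M := Real.sq_sqrt hM0
      have s1 := Real.sqrt_nonneg ρ
      have s2 := Real.sqrt_nonneg M
      have h1 : √ρ ^ 2 ≤ a * √ρ * √M + b * √M ^ 2 := by
        rw [e1, e2]; refine hmain.trans (le_of_eq ?_); rw [ha, hb]; ring
      have h2 : √ρ ≤ (a + b + 1) * √M := by
        by_contra hc
        push Not at hc
        have h3 : √M ≤ √ρ := by nlinarith
        have h4 : 0 < √ρ := lt_of_le_of_lt (by positivity) hc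
        nlinarith [mul_lt_mul_of_pos_right hc h4, mul_nonneg (mul_nonneg hb0 s2) (sub_nonneg.2 h3), mul_nonneg s2 s1]
      calc ρ = √ρ ^ 2 := e1.symm
        _ ≤ ((a + b + 1) * √M) ^ 2 := pow_le_pow_left₀ s1 h2 2
        _ = _ := by rw [mul_pow, e2]
    refine le_trans ?_ hfin
    refine le_trans ?_ (hRz v)
    refine Finset.sum_le_sum fun i _ => ?_
    rw [hre, ← pow_mul]
    have h1 := (Complex.abs_re_le_norm _).trans (norm_inner_le_norm (𝕜 := ℂ) (v i) (R (v i)))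
    simp only [OrthonormalBasis.norm_eq_one, one_mul] at h1
    exact pow_le_pow_left₀ (abs_nonneg _) h1 _

theorem schur_onb (m : ℕ) (c : ℝ) (n : ℕ) : ∀ (V : Type u) [NormedAddCommGroup V]
    [InnerProductSpace ℂ V] [FiniteDimensional ℂ V] (_ : Module.finrank ℂ V = n)
    (B : V →ₗ[ℂ] V) (_ : ∀ x, ‖(B ^ m) x‖ ≤ c * ‖x‖),
    ∃ e : OrthonormalBasis (Fin n) ℂ V, (∀ i j, i < j → inner ℂ (e i) (B (e j)) = 0) ∧
      ∀ i, ‖inner ℂ (e i) (B (e i))‖ ^ m ≤ c := by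
  induction n with
  | zero =>
    intro V _ _ _ hn B hB
    exact ⟨(stdOrthonormalBasis ℂ V).reindex (finCongr hn), fun i => i.elim0, fun i => i.elim0⟩
  | succ n ih =>
    intro V _ _ _ hn B hB
    have : Nontrivial V := Module.nontrivial_of_finrank_pos (R := ℂ) (by omega)
    obtain ⟨μ, hμ⟩ := Module.End.exists_eigenvalue (LinearMap.adjoint B)
    obtain ⟨w', hw'⟩ := hμ.exists_hasEigenvector
    obtain ⟨w, hw1, hw2⟩ : ∃ w : V, ‖w‖ = 1 ∧ LinearMap.adjoint B w = μ • w := by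
      refine ⟨(‖w'‖⁻¹ : ℂ) • w', ?_, ?_⟩
      · have := norm_ne_zero_iff.2 hw'.2
        rw [norm_smul]; simp [this]
      · rw [map_smul, hw'.apply_eq_smul, smul_comm]
    have hw0 : w ≠ 0 := by rintro rfl; simp at hw1
    have hadj : ∀ x, inner ℂ w (B x) = starRingEnd ℂ μ * inner ℂ w x := by
      intro x; rw [← LinearMap.adjoint_inner_left, hw2, inner_smul_left]
    have hadjm : ∀ (k : ℕ) x, inner ℂ w ((B ^ k) x) = (starRingEnd ℂ μ) ^ k * inner ℂ w x := by
      intro k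
      induction k with
      | zero => intro x; simp
      | succ k ihk =>
        intro x; rw [pow_succ', Module.End.mul_apply, hadj, ihk]; ring
    let W : Submodule ℂ V := (ℂ ∙ w)ᗮ
    have hWmem : ∀ x, x ∈ W ↔ inner ℂ w x = 0 := fun x => Submodule.mem_orthogonal_singleton_iff_inner_right
    have hBW : ∀ x ∈ W, B x ∈ W := by
      intro x hx; rw [hWmem] at hx ⊢; rw [hadj, hx, mul_zero]
    have : Fact (Module.finrank ℂ V = n + 1) := ⟨hn⟩
    have hWr : Module.finrank ℂ W = n := Submodule.finrank_orthogonal_span_singleton hw0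
    have hpow : ∀ (k : ℕ) (x : W), (((B.restrict hBW) ^ k) x : V) = (B ^ k) x := by
      intro k x
      rw [Module.End.pow_restrict k hBW]; rfl
    obtain ⟨e', he1, he2⟩ := ih W hWr (B.restrict hBW) (by
      intro x
      have := hB x
      rw [← hpow] at this; exact this)
    have hon : Orthonormal ℂ (Fin.cons w (fun i => (e' i : V)) : Fin (n + 1) → V) := by
      have hwe : ∀ i, inner ℂ w (e' i : V) = 0 := fun i => (hWmem _).1 (e' i).2
      have hee := e'.orthonormal
      rw [orthonormal_iff_ite] at hee ⊢
      intro i j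
      refine Fin.cases ?_ (fun i => ?_) i <;> refine Fin.cases ?_ (fun j => ?_) j
      · simp [hw1]
      · simp [hwe, (Fin.succ_ne_zero _).symm]
      · simp [inner_eq_zero_symm.1 (hwe i)]
      · have := hee i j
        simpa using this
    obtain ⟨e, he⟩ := Orthonormal.exists_orthonormalBasis_extension_of_card_eq (𝕜 := ℂ)
      (v := (Fin.cons w (fun i => (e' i : V)) : Fin (n + 1) → V)) (s := Set.univ)
      (by simpa using hn) (hon.comp _ Subtype.val_injective)
    have e0 : e 0 = w := by rw [he 0 trivial]; simp
    have es : ∀ i : Fin n, e i.succ = e' i := fun i => by rw [he _ trivial]; simp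
    refine ⟨e, ?_, ?_⟩
    · intro i j
      refine Fin.cases ?_ (fun i => ?_) i <;> refine Fin.cases ?_ (fun j => ?_) j
      · simp
      · intro _
        rw [e0, es]; exact (hWmem _).1 (hBW _ (e' j).2)
      · simp
      · intro h
        rw [es, es]
        exact he1 i j (by simpa using h)
    · intro i
      refine Fin.cases ?_ (fun i => ?_) i
      · rw [e0, hadj]
        have h1 := hadjm m w
        have h2 := (norm_inner_le_norm (𝕜 := ℂ) w ((B ^ m) w)).trans
          (mul_le_mul_of_nonneg_left (hB w) (norm_nonneg _))
        rw [h1] at h2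
        simpa [hw1] using h2
      · rw [es]; exact he2 i

theorem fin_main (k : ℕ) : ∃ K : ℝ, 0 ≤ K ∧ ∀ (V : Type u) [NormedAddCommGroup V]
    [InnerProductSpace ℂ V] [FiniteDimensional ℂ V] (n : ℕ) (_ : Module.finrank ℂ V = n)
    (B : V →ₗ[ℂ] V) (m : ℕ) (_ : m ≠ 0) (ε : ℝ) (_ : 0 ≤ ε) (_ : ∀ x, ‖(B ^ m) x‖ ≤ ε ^ m * ‖x‖) (M : ℝ)
    (_ : ∀ z : OrthonormalBasis (Fin n) ℂ V, ∑ i, |(inner ℂ (z i) (B (z i))).im| ^ (2 ^ (k + 1)) ≤ M)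
    (v : OrthonormalBasis (Fin n) ℂ V), ∃ x : Fin n → ℝ, ∑ i, |x i| ^ (2 ^ (k + 1)) ≤ K * M ∧
      ∀ i, |(inner ℂ (v i) (B (v i))).re| ≤ |x i| + ε := by
  obtain ⟨K, hK0, hK⟩ := macaev_fin.{u} k
  set p := 2 ^ (k + 1) with hp
  refine ⟨K * (2 ^ p * 2), by positivity, ?_⟩
  intro V _ _ _ n hn B m hm ε hε hB M hM v
  obtain ⟨e, he1, he2⟩ := schur_onb m (ε ^ m) n V hn B hB
  set d : Fin n → ℂ := fun i => inner ℂ (e i) (B (e i)) with hd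
  have hdε : ∀ i, ‖d i‖ ≤ ε := fun i => (pow_le_pow_iff_left₀ (norm_nonneg _) hε hm).1 (he2 i)
  set N : V →ₗ[ℂ] V := e.toBasis.constr ℂ (fun j => B (e j) - d j • e j) with hNdef
  have hNe : ∀ j, N (e j) = B (e j) - d j • e j := by
    intro j
    have := e.toBasis.constr_basis ℂ (fun j => B (e j) - d j • e j) j
    rw [OrthonormalBasis.coe_toBasis] at this
    exact this
  have hz : ∀ z, inner ℂ z (B z) = inner ℂ z (N z) + ∑ i, d i * ((‖inner ℂ (e i) z‖ ^ 2 : ℝ) : ℂ) := by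
    intro z
    have h1 : B z = N z + ∑ i, (inner ℂ (e i) z * d i) • e i := by
      conv_lhs => rw [← e.sum_repr' z]
      conv_rhs => rw [← e.sum_repr' z]
      simp only [map_sum, map_smul, hNe]
      rw [e.sum_repr' z, ← Finset.sum_add_distrib]
      refine Finset.sum_congr rfl fun i _ => ?_
      module
    rw [h1, inner_add_right, inner_sum]
    congr 1
    refine Finset.sum_congr rfl fun i _ => ?_
    rw [inner_smul_right, ← inner_conj_symm z (e i), mul_right_comm, Complex.mul_conj, Complex.normSq_eq_norm_sq, mul_comm]
  have hNnil : IsNilpotent N := by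
    have h0 : ∀ i j, i ≤ j → inner ℂ (e i) (N (e j)) = 0 := by
      intro i j hij
      rw [hNe, inner_sub_right, inner_smul_right]
      rcases hij.lt_or_eq with h | rfl
      · rw [he1 i j h, e.orthonormal.2 h.ne]; simp
      · simp [hd]
    have h1 : ∀ (k : ℕ) (j : Fin n), n - (j : ℕ) ≤ k → (N ^ k) (e j) = 0 := by
      intro k
      induction k with
      | zero => intro j hj; have := j.2; omega
      | succ k ihk =>
        intro j hj
        rw [pow_succ, Module.End.mul_apply, ← e.sum_repr' (N (e j)), map_sum]
        refine Finset.sum_eq_zero fun i _ => ?_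
        rw [map_smul]
        rcases le_or_gt i j with h | h
        · rw [h0 i j h, zero_smul]
        · rw [ihk i (by have : (j:ℕ) < i := h; omega), smul_zero]
    refine ⟨n, ?_⟩
    refine e.toBasis.ext fun j => ?_
    simpa using h1 n j (by omega)
  have hMz : ∀ z : OrthonormalBasis (Fin n) ℂ V,
      ∑ i, |(inner ℂ (z i) (N (z i))).im| ^ p ≤ 2 ^ p * 2 * M := by
    intro z
    have h1 : ∀ i, (inner ℂ (z i) (N (z i))).im = (inner ℂ (z i) (B (z i))).im
        + - (∑ l, (d l).im * ‖inner ℂ (e l) (z i)‖ ^ 2) := by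
      intro i
      rw [hz (z i), Complex.add_im, Complex.im_sum]
      simp only [Complex.im_mul_ofReal]; ring
    calc ∑ i, |(inner ℂ (z i) (N (z i))).im| ^ p
        ≤ ∑ i, 2 ^ p * (|(inner ℂ (z i) (B (z i))).im| ^ p
          + |∑ l, (d l).im * ‖inner ℂ (e l) (z i)‖ ^ 2| ^ p) := by
          refine Finset.sum_le_sum fun i _ => ?_
          rw [h1 i]
          refine (pow_le_pow_left₀ (abs_nonneg _) (abs_add_le _ _) p).trans ?_
          rw [abs_neg]
          refine (add_pow_le (abs_nonneg _) (abs_nonneg _) p).trans ?_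
          gcongr
          · norm_num
          · exact Nat.sub_le _ _
      _ = 2 ^ p * (∑ i, |(inner ℂ (z i) (B (z i))).im| ^ p
          + ∑ i, |∑ l, (d l).im * ‖inner ℂ (e l) (z i)‖ ^ 2| ^ p) := by
          rw [← Finset.mul_sum, Finset.sum_add_distrib]
      _ ≤ 2 ^ p * (M + M) := by
          gcongr
          · exact hM z
          · exact (onb_jensen e z (fun l => (d l).im) p).trans (hM e)
      _ = _ := by ring
  refine ⟨fun i => (inner ℂ (v i) (N (v i))).re, ?_, ?_⟩
  · refine (hK V n hn N hNnil _ hMz v).trans (le_of_eq (by ring))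
  · intro i
    rw [hz (v i), Complex.add_re]
    refine (abs_add_le _ _).trans ?_
    gcongr
    refine (Complex.abs_re_le_norm _).trans ((norm_sum_le _ _).trans ?_)
    calc ∑ l, ‖d l * ((‖inner ℂ (e l) (v i)‖ ^ 2 : ℝ) : ℂ)‖
        ≤ ∑ l, ε * ‖inner ℂ (e l) (v i)‖ ^ 2 := by
          refine Finset.sum_le_sum fun l _ => ?_
          rw [norm_mul, Complex.norm_real, Real.norm_of_nonneg (by positivity)]
          exact mul_le_mul_of_nonneg_right (hdε l) (by positivity)
      _ = ε := by rw [← Finset.mul_sum, e.sum_sq_norm_inner_right]; simp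

section Hilb

variable {H : Type u} [NormedAddCommGroup H] [InnerProductSpace ℂ H]

theorem compact_approx {A : H →L[ℂ] H} (hA : IsCompactOperator (⇑A)) {δ : ℝ} (hδ : 0 < δ) :
    ∃ W : Submodule ℂ H, FiniteDimensional ℂ W ∧ ∀ (V : Submodule ℂ H) [FiniteDimensional ℂ V],
      W ≤ V → ‖A - V.starProjection ∘L A‖ ≤ δ := by
  have hc := hA.isCompact_closure_image_closedBall (f := (A : H →ₗ[ℂ] H)) 1
  have htb := hc.totallyBounded.subset subset_closure
  obtain ⟨t, ht, hcov⟩ := Metric.totallyBounded_iff.1 htb δ hδ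
  refine ⟨Submodule.span ℂ t, FiniteDimensional.span_of_finite ℂ ht, ?_⟩
  intro V _ hV
  refine ContinuousLinearMap.opNorm_le_of_unit_norm hδ.le ?_
  intro x hx
  have hmem : A x ∈ (fun x => (A : H →ₗ[ℂ] H) x) '' Metric.closedBall 0 1 := ⟨x, by simp [hx], rfl⟩
  have := hcov hmem
  simp only [Set.mem_iUnion, Metric.mem_ball] at this
  obtain ⟨y, hy, hd⟩ := this
  have hyV : y ∈ V := hV (Submodule.subset_span hy)
  rw [dist_eq_norm] at hd
  refine le_trans ?_ hd.le
  simp only [sub_apply, ContinuousLinearMap.comp_apply]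
  rw [Submodule.starProjection_minimal]
  exact ciInf_le ⟨0, by rintro _ ⟨z, rfl⟩; exact norm_nonneg _⟩ (⟨y, hyV⟩ : V)

variable [CompleteSpace H]

theorem compact_adjoint {A : H →L[ℂ] H} (hA : IsCompactOperator (⇑A)) :
    IsCompactOperator (⇑(ContinuousLinearMap.adjoint A)) := by
  have hcl := isClosed_setOfPred_isCompactOperator (σ₁₂ := RingHom.id ℂ) (M₁ := H) (M₂ := H)
  have : ContinuousLinearMap.adjoint A ∈ {f : H →L[ℂ] H | IsCompactOperator f} := by
    rw [← hcl.closure_eq, Metric.mem_closure_iff]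
    intro ε hε
    obtain ⟨W, hW, hV⟩ := compact_approx hA (half_pos hε)
    refine ⟨ContinuousLinearMap.adjoint (W.starProjection ∘L A), ?_, ?_⟩
    · rw [ContinuousLinearMap.adjoint_comp]
      have h1 : IsCompactOperator (⇑(W.orthogonalProjectionOnto : H →L[ℂ] W)) := by
        have h2 : IsCompactOperator (id : W → W) := isCompactOperator_id_iff_finiteDimensional (𝕜 := ℂ) |>.2 hW
        exact h2.comp_clm W.orthogonalProjectionOnto
      have h3 : IsCompactOperator (⇑(W.starProjection)) := by
        have := h1.clm_comp W.subtypeL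
        exact this
      have h4 : ContinuousLinearMap.adjoint W.starProjection = W.starProjection :=
        (isSelfAdjoint_starProjection W).adjoint_eq
      rw [h4]
      exact h3.clm_comp (ContinuousLinearMap.adjoint A)
    · rw [dist_eq_norm, ← map_sub, LinearIsometryEquiv.norm_map]
      exact (hV W le_rfl).trans_lt (half_lt_self hε)
  exact this

theorem quasinil {A : H →L[ℂ] H} (hA : IsCompactOperator (⇑A))
    (h : ¬ ∃ μ : ℂ, μ ≠ 0 ∧ Module.End.HasEigenvalue (ContinuousLinearMap.adjoint A : H →ₗ[ℂ] H) μ)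
    {ε : ℝ} (hε : 0 < ε) : ∃ m : ℕ, m ≠ 0 ∧ ‖A ^ m‖ < ε ^ m := by
  push Not at h
  set B := ContinuousLinearMap.adjoint A with hB
  have hsp : spectralRadius ℂ B = 0 := by
    refine le_antisymm ?_ bot_le
    refine iSup₂_le fun μ hμ => ?_
    by_cases h0 : μ = 0
    · simp [h0]
    · exact absurd (((compact_adjoint hA).hasEigenvalue_iff_mem_spectrum h0).2 hμ) (h μ h0)
  have ht := spectrum.pow_norm_pow_one_div_tendsto_nhds_spectralRadius B
  rw [hsp] at ht
  have hev := ht.eventually (gt_mem_nhds (ENNReal.ofReal_pos.2 hε))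
  obtain ⟨m, hm, hm0⟩ := (hev.and (eventually_gt_atTop 0)).exists
  refine ⟨m, hm0.ne', ?_⟩
  rw [ENNReal.ofReal_lt_ofReal_iff hε] at hm
  have hn : ‖A ^ m‖ = ‖B ^ m‖ := by
    rw [hB, ← ContinuousLinearMap.star_eq_adjoint, ← star_pow, norm_star]
  rw [hn]
  have h1 := Real.rpow_lt_rpow (by positivity) hm (z := (m:ℝ)) (by exact_mod_cast hm0)
  rw [← Real.rpow_mul (norm_nonneg _), one_div, inv_mul_cancel₀ (by exact_mod_cast hm0.ne'), Real.rpow_one,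
    Real.rpow_natCast] at h1
  exact h1

theorem hilb_main (k : ℕ) : ∃ K : ℝ, 0 ≤ K ∧ ∀ (H : Type u) [NormedAddCommGroup H]
    [InnerProductSpace ℂ H] [CompleteSpace H] (A : H →L[ℂ] H) (_ : IsCompactOperator (⇑A))
    (_ : ¬ ∃ μ : ℂ, μ ≠ 0 ∧ Module.End.HasEigenvalue (ContinuousLinearMap.adjoint A : H →ₗ[ℂ] H) μ)
    (M : ℝ)
    (_ : ∀ (n : ℕ) (z : Fin n → H) (_ : Orthonormal ℂ z),
      ∑ i, |(inner ℂ (z i) (A (z i))).im| ^ (2 ^ (k + 1)) ≤ M)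
    (n : ℕ) (f : Fin n → H) (_ : Orthonormal ℂ f) (ε : ℝ) (_ : 0 < ε),
    ∃ x : Fin n → ℝ, ∑ i, |x i| ^ (2 ^ (k + 1)) ≤ K * M ∧
      ∀ i, |(inner ℂ (f i) (A (f i))).re| ≤ |x i| + ε := by
  obtain ⟨K, hK0, hK⟩ := fin_main.{u} k
  refine ⟨K, hK0, ?_⟩
  intro H _ _ _ A hA hno M hM n f hf ε hε
  obtain ⟨m, hm0, hm⟩ := quasinil hA hno hε
  have hcont : Tendsto (fun B : H →L[ℂ] H => ‖B ^ m‖) (𝓝 A) (𝓝 ‖A ^ m‖) :=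
    (continuous_norm.comp (continuous_pow m)).tendsto A
  obtain ⟨δ, hδ, hball⟩ := Metric.eventually_nhds_iff.1 (hcont.eventually (gt_mem_nhds hm))
  obtain ⟨W, hW, hV⟩ := compact_approx hA (half_pos hδ)
  let V : Submodule ℂ H := W ⊔ Submodule.span ℂ (Set.range f)
  have : FiniteDimensional ℂ (Submodule.span ℂ (Set.range f)) :=
    FiniteDimensional.span_of_finite ℂ (Set.finite_range f)
  have hVf : FiniteDimensional ℂ V := inferInstance
  have hfV : ∀ i, f i ∈ V := fun i => (le_sup_right : _ ≤ V) (Submodule.subset_span ⟨i, rfl⟩)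
  set B₀ : H →L[ℂ] H := V.starProjection ∘L A with hB₀
  have hB₀m : ‖B₀ ^ m‖ < ε ^ m := by
    apply hball
    rw [dist_comm, dist_eq_norm]
    exact (hV V le_sup_left).trans_lt (half_lt_self hδ)
  let B : V →ₗ[ℂ] V := (V.orthogonalProjectionOnto : H →ₗ[ℂ] V) ∘ₗ (A : H →ₗ[ℂ] H) ∘ₗ V.subtype
  have hBB : ∀ x : V, ((B x : V) : H) = B₀ x := fun x => rfl
  have hBpow : ∀ (j : ℕ) (x : V), (((B ^ j) x : V) : H) = (B₀ ^ j) x := by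
    intro j
    induction j with
    | zero => intro x; simp
    | succ j ihj => intro x; rw [pow_succ, pow_succ, Module.End.mul_apply, ihj, hBB]; rfl
  have hin : ∀ x : V, inner ℂ x (B x) = inner ℂ (x : H) (A x) := by
    intro x
    rw [Submodule.coe_inner, hBB, hB₀, ContinuousLinearMap.comp_apply,
      ← Submodule.inner_starProjection_left_eq_right, Submodule.starProjection_eq_self_iff.2 x.2]
  have hB1 : ∀ x, ‖(B ^ m) x‖ ≤ ε ^ m * ‖x‖ := by
    intro x
    change ‖(((B ^ m) x : V) : H)‖ ≤ ε ^ m * ‖(x : H)‖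
    rw [hBpow]
    refine ((B₀ ^ m).le_opNorm _).trans ?_
    exact mul_le_mul_of_nonneg_right hB₀m.le (norm_nonneg _)
  set d := Module.finrank ℂ V with hd
  let f' : Fin n → V := fun i => ⟨f i, hfV i⟩
  have hf' : Orthonormal ℂ f' := by
    rw [orthonormal_iff_ite] at hf ⊢
    intro i j; exact hf i j
  have hnd : n ≤ d := by
    have := hf'.linearIndependent.fintype_card_le_finrank
    simpa using this
  obtain ⟨v, hv⟩ := Orthonormal.exists_orthonormalBasis_extension_of_card_eq (𝕜 := ℂ)
      (E := V) (ι := Fin d) (v := fun i => if h : (i : ℕ) < n then f' ⟨i, h⟩ else 0)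
      (s := {i | (i : ℕ) < n}) (by simp [hd]) (by
        have h1 : Orthonormal ℂ (fun i : {i : Fin d | (i : ℕ) < n} => f' ⟨i.1, i.2⟩) :=
          hf'.comp _ (fun i j hij => by
            simp only [Fin.mk.injEq] at hij
            exact Subtype.ext (Fin.ext hij))
        have h2 : Set.domRestrict {i : Fin d | (i : ℕ) < n}
            (fun i => if h : (i : ℕ) < n then f' ⟨i, h⟩ else 0) =
            (fun i : {i : Fin d | (i : ℕ) < n} => f' ⟨i.1, i.2⟩) := by
          funext i
          have := i.2
          simp only [Set.mem_ofPred_eq] at this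
          simp [Set.domRestrict, this]
        rw [h2]
        exact h1)
  obtain ⟨x, hx1, hx2⟩ := hK V d rfl B m hm0 ε hε.le hB1 M (by
    intro z
    refine le_trans (le_of_eq ?_) (hM d (fun i => (z i : H)) (by
      have := z.orthonormal
      rw [orthonormal_iff_ite] at this ⊢
      intro i j; exact this i j))
    simp only [hin]) v
  have hvf : ∀ i : Fin n, (v (Fin.castLE hnd i) : H) = f i := by
    intro i
    rw [hv _ (by simp)]; simp [f']
  refine ⟨fun i => x (Fin.castLE hnd i), ?_, ?_⟩
  · refine le_trans ?_ hx1
    rw [← Finset.sum_image (g := Fin.castLE hnd) (f := fun i => |x i| ^ 2 ^ (k + 1))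
      (fun a _ b _ h => Fin.castLE_injective hnd h)]
    exact Finset.sum_le_sum_of_subset_of_nonneg (Finset.subset_univ _) (fun i _ _ => by positivity)
  · intro i
    have := hx2 (Fin.castLE hnd i)
    rwa [hin, hvf] at this

end Hilb

section SNum

variable {H : Type u} [NormedAddCommGroup H] [InnerProductSpace ℂ H]

theorem sNum_nonneg (T : H →L[ℂ] H) (n : ℕ) : 0 ≤ sNum T n :=
  Real.iInf_nonneg fun _ => norm_nonneg _

theorem sNum_le_of_rank (T F : H →L[ℂ] H) (n : ℕ)
    (hF : Module.rank ℂ (LinearMap.range (F : H →ₗ[ℂ] H)) < (n : Cardinal)) :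
    sNum T n ≤ ‖T - F‖ :=
  ciInf_le (f := fun F : {F : H →L[ℂ] H //
    Module.rank ℂ (LinearMap.range (F : H →ₗ[ℂ] H)) < (n : Cardinal)} => ‖T - (F : H →L[ℂ] H)‖)
    ⟨0, by rintro _ ⟨z, rfl⟩; exact norm_nonneg _⟩ ⟨F, hF⟩

theorem rank_zero_lt (n : ℕ) (hn : 0 < n) :
    Module.rank ℂ (LinearMap.range ((0 : H →L[ℂ] H) : H →ₗ[ℂ] H)) < (n : Cardinal) := by
  have : LinearMap.range ((0 : H →L[ℂ] H) : H →ₗ[ℂ] H) = ⊥ := by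
    rw [ContinuousLinearMap.toLinearMap_zero, LinearMap.range_zero]
  rw [this, rank_bot]
  exact_mod_cast hn

theorem sNum_le_norm (T : H →L[ℂ] H) (n : ℕ) (hn : 0 < n) : sNum T n ≤ ‖T‖ := by
  simpa using sNum_le_of_rank T 0 n (rank_zero_lt n hn)

theorem exists_approx (T : H →L[ℂ] H) (n : ℕ) (hn : 0 < n) {η : ℝ} (hη : 0 < η) :
    ∃ F : H →L[ℂ] H, Module.rank ℂ (LinearMap.range (F : H →ₗ[ℂ] H)) < (n : Cardinal) ∧
      ‖T - F‖ < sNum T n + η := by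
  have : Nonempty {F : H →L[ℂ] H //
    Module.rank ℂ (LinearMap.range (F : H →ₗ[ℂ] H)) < (n : Cardinal)} := ⟨⟨0, rank_zero_lt n hn⟩⟩
  obtain ⟨F, hF⟩ := exists_lt_of_ciInf_lt (f := fun F : {F : H →L[ℂ] H //
    Module.rank ℂ (LinearMap.range (F : H →ₗ[ℂ] H)) < (n : Cardinal)} => ‖T - (F : H →L[ℂ] H)‖)
    (a := sNum T n + η) (by change sNum T n < _; linarith)
  exact ⟨F.1, F.2, hF⟩

theorem sNum_anti (T : H →L[ℂ] H) {m n : ℕ} (hm : 0 < m) (hmn : m ≤ n) : sNum T n ≤ sNum T m := by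
  refine le_of_forall_pos_le_add fun η hη => ?_
  obtain ⟨F, hF, h⟩ := exists_approx T m hm hη
  exact (sNum_le_of_rank T F n (hF.trans_le (by exact_mod_cast hmn))).trans h.le

/-- sum of diagonal entries of a finite rank operator -/
theorem sum_diag_finrank (F : H →L[ℂ] H) (n : ℕ)
    (hF : Module.rank ℂ (LinearMap.range (F : H →ₗ[ℂ] H)) < (n : Cardinal))
    {ι : Type*} (f : ι → H) (hf : Orthonormal ℂ f) (S : Finset ι) :
    ∑ i ∈ S, ‖inner ℂ (f i) (F (f i))‖ ≤ ‖F‖ * (√S.card * √n) := by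
  set U := LinearMap.range (F : H →ₗ[ℂ] H) with hU
  have hfd : FiniteDimensional ℂ U :=
    Module.rank_lt_aleph0_iff.1 (hF.trans (Cardinal.natCast_lt_aleph0))
  have hfr : Module.finrank ℂ U ≤ n := by
    have : (Module.finrank ℂ U : Cardinal) < n := by rwa [Module.finrank_eq_rank]
    exact_mod_cast this.le
  let b := stdOrthonormalBasis ℂ U
  have hb : Orthonormal ℂ (fun l => (b l : H)) := by
    have := b.orthonormal
    rw [orthonormal_iff_ite] at this ⊢
    intro i j; exact this i j
  have hin : ∀ (u : U) x, inner ℂ (u : H) (U.starProjection x) = inner ℂ (u : H) x := by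
    intro u x
    rw [← Submodule.inner_starProjection_left_eq_right, Submodule.starProjection_eq_self_iff.2 u.2]
  have h1 : ∀ i, ‖inner ℂ (f i) (F (f i))‖ ≤ ‖U.starProjection (f i)‖ * ‖F‖ := by
    intro i
    have h2 : inner ℂ (f i) (F (f i)) = inner ℂ (U.starProjection (f i)) (F (f i)) := by
      rw [Submodule.inner_starProjection_left_eq_right,
        Submodule.starProjection_eq_self_iff.2 (show F (f i) ∈ U from ⟨f i, rfl⟩)]
    rw [h2]
    refine (norm_inner_le_norm _ _).trans ?_
    gcongr
    have := F.le_opNorm (f i)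
    rwa [hf.1 i, mul_one] at this
  have h3 : ∑ i ∈ S, ‖U.starProjection (f i)‖ ^ 2 ≤ n := by
    have h4 : ∀ i, ‖U.starProjection (f i)‖ ^ 2 = ∑ l, ‖inner ℂ (f i) (b l : H)‖ ^ 2 := by
      intro i
      have := b.sum_sq_norm_inner_right (U.orthogonalProjectionOnto (f i))
      have h5 : ‖U.orthogonalProjectionOnto (f i)‖ = ‖U.starProjection (f i)‖ := rfl
      rw [← h5, ← this]
      refine Finset.sum_congr rfl fun l _ => ?_
      have h6 : inner ℂ (b l) (U.orthogonalProjectionOnto (f i)) = inner ℂ (b l : H) (f i) := hin (b l) (f i)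
      rw [h6, norm_inner_symm]
    simp only [h4]
    rw [Finset.sum_comm]
    calc ∑ l, ∑ i ∈ S, ‖inner ℂ (f i) (b l : H)‖ ^ 2 ≤ ∑ l : Fin (Module.finrank ℂ U), (1 : ℝ) := by
          refine Finset.sum_le_sum fun l _ => ?_
          refine (hf.sum_inner_products_le _).trans ?_
          rw [hb.1 l]; simp
      _ ≤ n := by simp; exact_mod_cast hfr
  calc ∑ i ∈ S, ‖inner ℂ (f i) (F (f i))‖ ≤ ∑ i ∈ S, ‖U.starProjection (f i)‖ * ‖F‖ :=
        Finset.sum_le_sum fun i _ => h1 i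
    _ = ‖F‖ * ∑ i ∈ S, 1 * ‖U.starProjection (f i)‖ := by
        rw [← Finset.sum_mul, mul_comm]; simp
    _ ≤ _ := by
        gcongr
        refine (Real.sum_mul_le_sqrt_mul_sqrt _ _ _).trans ?_
        gcongr
        simp

theorem min_diag (T : H →L[ℂ] H) (n : ℕ) (hn : 0 < n)
    {ι : Type*} (f : ι → H) (hf : Orthonormal ℂ f) (S : Finset ι) (hS : S.Nonempty) :
    ∃ i ∈ S, ‖inner ℂ (f i) (T (f i))‖ ≤ sNum T n + (2 * ‖T‖) * √(n / S.card) := by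
  obtain ⟨i, hi, hmin⟩ := S.exists_min_image (fun i => ‖inner ℂ (f i) (T (f i))‖) hS
  refine ⟨i, hi, ?_⟩
  set G := √((n:ℝ) / S.card) with hG
  have hG0 : 0 ≤ G := Real.sqrt_nonneg _
  refine le_of_forall_pos_le_add fun η' hη' => ?_
  set η := η' / (1 + G) with hηd
  have hη : 0 < η := by positivity
  obtain ⟨F, hF, h⟩ := exists_approx T n hn hη
  have hc : (0:ℝ) < S.card := by exact_mod_cast hS.card_pos
  have hFn : ‖F‖ ≤ 2 * ‖T‖ + η := by
    have h1 : ‖F‖ ≤ ‖T‖ + ‖T - F‖ := by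
      have := norm_sub_le T (T - F); simpa using this
    have := sNum_le_norm T n hn
    linarith
  have h1 : S.card * ‖inner ℂ (f i) (T (f i))‖ ≤ S.card * (sNum T n + η) + ‖F‖ * (√S.card * √n) := by
    calc S.card * ‖inner ℂ (f i) (T (f i))‖ = ∑ j ∈ S, ‖inner ℂ (f i) (T (f i))‖ := by simp
      _ ≤ ∑ j ∈ S, ((sNum T n + η) + ‖inner ℂ (f j) (F (f j))‖) := by
          refine Finset.sum_le_sum fun j hj => (hmin j hj).trans ?_
          have h2 : inner ℂ (f j) (T (f j)) = inner ℂ (f j) ((T - F) (f j)) + inner ℂ (f j) (F (f j)) := by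
            rw [← inner_add_right]; simp
          rw [h2]
          refine (norm_add_le _ _).trans ?_
          gcongr
          refine (norm_inner_le_norm _ _).trans ?_
          have h3 := (T - F).le_opNorm (f j)
          rw [hf.1 j, mul_one] at h3
          rw [hf.1 j, one_mul]
          linarith
      _ = S.card * (sNum T n + η) + ∑ j ∈ S, ‖inner ℂ (f j) (F (f j))‖ := by
          rw [Finset.sum_add_distrib]; simp; ring
      _ ≤ _ := by gcongr; exact sum_diag_finrank F n hF f hf S
  have h2 : √(S.card:ℝ) * √n = S.card * G := by
    rw [hG, Real.sqrt_div (by positivity)]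
    have : √(S.card:ℝ) ≠ 0 := (Real.sqrt_pos.2 hc).ne'
    field_simp
    rw [Real.sq_sqrt hc.le]
  rw [h2] at h1
  have h3 : ‖inner ℂ (f i) (T (f i))‖ ≤ sNum T n + η + ‖F‖ * G := by
    refine le_of_mul_le_mul_left (h1.trans (le_of_eq (by ring))) hc
  have h4 : ‖F‖ * G ≤ (2 * ‖T‖ + η) * G := by gcongr
  have h5 : η * (1 + G) = η' := by rw [hηd]; field_simp
  nlinarith

theorem sum_of_min {ι : Type*} [DecidableEq ι] (y : ι → ℝ) (B : ℝ)
    (h : ∀ S : Finset ι, S.Nonempty → ∃ i ∈ S, y i ≤ B * (1 / (S.card : ℝ) ^ 2)) :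
    ∀ (n : ℕ) (S : Finset ι), S.card = n → ∑ i ∈ S, y i ≤ B * ∑ j ∈ Finset.range n, 1 / ((j + 1 : ℕ) : ℝ) ^ 2 := by
  intro n
  induction n with
  | zero => intro S hS; rw [Finset.card_eq_zero] at hS; simp [hS]
  | succ n ih =>
    intro S hS
    obtain ⟨i, hi, hy⟩ := h S (Finset.card_pos.1 (by omega))
    rw [← Finset.add_sum_erase S y hi, Finset.sum_range_succ, mul_add, add_comm]
    rw [hS] at hy
    exact add_le_add (ih _ (by rw [Finset.card_erase_of_mem hi, hS]; rfl)) hy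

theorem schatten_diag (T : H →L[ℂ] H) (q : ℝ) (hq0 : 0 < q)
    (hT : Summable (fun n : ℕ => sNum T (n + 1) ^ q)) :
    ∃ (k : ℕ) (M : ℝ), 0 ≤ M ∧ ∀ (n : ℕ) (f : Fin n → H) (_ : Orthonormal ℂ f),
      ∑ i, ‖inner ℂ (f i) (T (f i))‖ ^ (2 ^ (k + 1)) ≤ M := by
  obtain ⟨j, hj⟩ := pow_unbounded_of_one_lt (max q 2) (one_lt_two (α := ℝ))
  set r : ℕ := 2 ^ j with hr
  have hrq : q ≤ r := by rw [hr]; push_cast; exact (le_max_left _ _).trans hj.le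
  have hr2 : 2 ≤ r := by
    have : (2:ℝ) ≤ r := by rw [hr]; push_cast; exact (le_max_right _ _).trans hj.le
    exact_mod_cast this
  set S₀ : ℝ := (∑' n, sNum T (n + 1) ^ q) * ‖T‖ ^ ((r:ℝ) - q) with hS₀
  have hS₀0 : 0 ≤ S₀ := mul_nonneg (tsum_nonneg fun n => Real.rpow_nonneg (sNum_nonneg _ _) _) (by positivity)
  have hs : ∀ n : ℕ, 0 < n → n * sNum T n ^ r ≤ S₀ := by
    intro n hn
    have h0 := sNum_nonneg T n
    have h1 : n * sNum T n ^ q ≤ ∑' n, sNum T (n + 1) ^ q := by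
      calc n * sNum T n ^ q = ∑ i ∈ Finset.range n, sNum T n ^ q := by simp
        _ ≤ ∑ i ∈ Finset.range n, sNum T (i + 1) ^ q := by
            refine Finset.sum_le_sum fun i hi => ?_
            rw [Finset.mem_range] at hi
            exact Real.rpow_le_rpow h0 (sNum_anti T (by omega) (by omega)) hq0.le
        _ ≤ _ := hT.sum_le_tsum _ (fun i _ => Real.rpow_nonneg (sNum_nonneg _ _) _)
    have h2 : sNum T n ^ r = sNum T n ^ q * sNum T n ^ ((r:ℝ) - q) := by
      rw [← Real.rpow_natCast, ← Real.rpow_add_of_nonneg h0 hq0.le (by linarith)]; congr 1; ring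
    rw [h2, ← mul_assoc, hS₀]
    exact mul_le_mul h1 (Real.rpow_le_rpow h0 (sNum_le_norm T n hn) (by linarith))
      (Real.rpow_nonneg h0 _) (le_trans (by positivity) h1)
  set B : ℝ := 2 ^ (4 * r) * (S₀ ^ 4 + (2 * ‖T‖) ^ (4 * r) * 4 ^ r) with hB
  have hB0 : 0 ≤ B := by positivity
  have hsum : Summable (fun j : ℕ => 1 / ((j + 1 : ℕ) : ℝ) ^ 2) :=
    (summable_nat_add_iff 1 (f := fun j : ℕ => 1 / (j : ℝ) ^ 2)).2 (Real.summable_one_div_nat_pow.2 (by norm_num))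
  have hP : 2 ^ (j + 1 + 1) = 4 * r := by rw [hr]; ring
  refine ⟨j + 1, B * ∑' j : ℕ, 1 / ((j + 1 : ℕ) : ℝ) ^ 2,
    mul_nonneg hB0 (tsum_nonneg fun _ => by positivity), ?_⟩
  intro n f hf
  rw [hP]
  refine (sum_of_min (fun i => ‖inner ℂ (f i) (T (f i))‖ ^ (4 * r)) B ?_ _ Finset.univ rfl).trans ?_
  swap
  · exact mul_le_mul_of_nonneg_left (hsum.sum_le_tsum _ (fun _ _ => by positivity)) hB0
  intro S hS
  set m := S.card with hm
  have hm1 : 1 ≤ m := hS.card_pos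
  set l := Nat.sqrt m + 1 with hl
  obtain ⟨i, hi, hle⟩ := min_diag T l (by omega) f hf S hS
  refine ⟨i, hi, ?_⟩
  have hl1 : m ≤ l ^ 2 := by have := Nat.lt_succ_sqrt m; rw [pow_two]; exact this.le
  have hl2 : l ^ 2 ≤ 4 * m := by
    have h1 := Nat.sqrt_le m
    have h2 : 1 ≤ Nat.sqrt m := Nat.le_sqrt.2 (by omega)
    rw [hl]; nlinarith
  have hl1' : (m:ℝ) ≤ (l:ℝ) ^ 2 := by exact_mod_cast hl1
  have hl2' : (l:ℝ) ^ 2 ≤ 4 * m := by exact_mod_cast hl2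
  have hm1' : (1:ℝ) ≤ m := by exact_mod_cast hm1
  have hs0 := sNum_nonneg T l
  have hb1 : sNum T l ^ (4 * r) ≤ S₀ ^ 4 * (1 / (m:ℝ) ^ 2) := by
    have h1 := pow_le_pow_left₀ (by positivity) (hs l (by omega)) 4
    rw [mul_pow, ← pow_mul, mul_comm r 4] at h1
    rw [mul_one_div, le_div_iff₀ (by positivity)]
    have h2 : (m:ℝ) ^ 2 ≤ (l:ℝ) ^ 4 := by
      calc (m:ℝ) ^ 2 ≤ ((l:ℝ) ^ 2) ^ 2 := by gcongr
        _ = _ := by ring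
    calc sNum T l ^ (4 * r) * (m:ℝ) ^ 2 ≤ sNum T l ^ (4 * r) * (l:ℝ) ^ 4 := by gcongr
      _ ≤ _ := by rw [mul_comm]; exact h1
  have hb2 : √((l:ℝ) / m) ^ (4 * r) ≤ 4 ^ r * (1 / (m:ℝ) ^ 2) := by
    have h1 : √((l:ℝ) / m) ^ (4 * r) = (((l:ℝ) / m) ^ 2) ^ r := by
      rw [← pow_mul, show 4 * r = 2 * (2 * r) by ring, pow_mul, Real.sq_sqrt (by positivity)]
    rw [h1]
    have h2 : ((l:ℝ) / m) ^ 2 ≤ 4 / m := by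
      rw [div_pow, div_le_div_iff₀ (by positivity) (by positivity)]
      nlinarith
    calc (((l:ℝ) / m) ^ 2) ^ r ≤ (4 / m) ^ r := by gcongr
      _ = 4 ^ r * (1 / (m:ℝ) ^ r) := by rw [div_pow]; ring
      _ ≤ _ := by gcongr
  calc ‖inner ℂ (f i) (T (f i))‖ ^ (4 * r) ≤ (sNum T l + (2 * ‖T‖) * √(l / m)) ^ (4 * r) := by gcongr
    _ ≤ 2 ^ (4 * r - 1) * (sNum T l ^ (4 * r) + ((2 * ‖T‖) * √(l / m)) ^ (4 * r)) :=
        add_pow_le hs0 (by positivity) _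
    _ ≤ 2 ^ (4 * r) * (S₀ ^ 4 * (1 / (m:ℝ) ^ 2) + (2 * ‖T‖) ^ (4 * r) * (4 ^ r * (1 / (m:ℝ) ^ 2))) := by
        rw [mul_pow (2 * ‖T‖)]
        gcongr
        · norm_num
        · exact Nat.sub_le _ _
    _ = B * (1 / (m:ℝ) ^ 2) := by rw [hB]; ring

theorem lower_family [CompleteSpace H] (C : H →L[ℂ] H) (hC : C.IsPositive) (k : ℕ) (s : ℝ) (hs0 : 0 ≤ s)
    (hs : s < sNum C (2 * k)) : ∀ j ≤ k, ∃ f : Fin j → H, Orthonormal ℂ f ∧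
      ∀ i, s ≤ (inner ℂ (f i) (C (f i))).re := by
  intro j
  induction j with
  | zero =>
    intro _
    exact ⟨Fin.elim0, ⟨fun i => i.elim0, fun i => i.elim0⟩, fun i => i.elim0⟩
  | succ j ih =>
    intro hj
    obtain ⟨f, hf, hfs⟩ := ih (by omega)
    set U : Submodule ℂ H := Submodule.span ℂ (Set.range f) with hU
    have hUfd : FiniteDimensional ℂ U := FiniteDimensional.span_of_finite ℂ (Set.finite_range f)
    have hfr : Module.finrank ℂ U ≤ j := by
      have := finrank_range_le_card (R := ℂ) f
      simpa [Set.finrank] using this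
    obtain ⟨w, hw1, hwU, hws⟩ : ∃ w : H, ‖w‖ = 1 ∧ w ∈ Uᗮ ∧ s ≤ (inner ℂ w (C w)).re := by
      by_contra hcon
      push Not at hcon
      set P := U.starProjection with hP
      set Q := Uᗮ.starProjection with hQ
      have hPQ : ∀ x, x = P x + Q x := fun x => (U.starProjection_add_starProjection_orthogonal x).symm
      have hQs : ∀ x y, inner ℂ (Q x) y = inner ℂ x (Q y) := fun x y =>
        Submodule.inner_starProjection_left_eq_right _ x y
      set G := Q ∘L C ∘L Q with hG
      have hGle : ‖G‖ ≤ s := by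
        have hGs : (G : H →L[ℂ] H).IsSymmetric := by
          intro x y
          change inner ℂ (Q (C (Q x))) y = inner ℂ x (Q (C (Q y)))
          rw [hQs, ← hQs x]
          exact hC.isSymmetric _ _
        rw [G.norm_eq_iSup_rayleighQuotient hGs]
        refine ciSup_le fun x => ?_
        have h1 : G.reApplyInnerSelf x = (inner ℂ (Q x) (C (Q x))).re := by
          rw [ContinuousLinearMap.reApplyInnerSelf_apply]
          change (inner ℂ (Q (C (Q x))) x).re = _
          rw [hQs]
          exact congrArg Complex.re (hC.isSymmetric _ _)
        have h2 : 0 ≤ (inner ℂ (Q x) (C (Q x))).re := by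
          have := hC.re_inner_nonneg_right (Q x); simpa using this
        have h3 : (inner ℂ (Q x) (C (Q x))).re ≤ s * ‖Q x‖ ^ 2 := by
          by_cases h0 : Q x = 0
          · simp [h0]
          have hn0 : ‖Q x‖ ≠ 0 := norm_ne_zero_iff.2 h0
          have h4 := hcon ((‖Q x‖⁻¹ : ℂ) • Q x) (by rw [norm_smul]; simp [hn0])
            (Submodule.smul_mem _ _ (Submodule.starProjection_apply_mem _ _))
          rw [map_smul, inner_smul_left, inner_smul_right, ← Complex.ofReal_inv, Complex.conj_ofReal,
            Complex.re_ofReal_mul, Complex.re_ofReal_mul] at h4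
          have h5 : 0 < ‖Q x‖ ^ 2 := by positivity
          have h6 : (inner ℂ (Q x) (C (Q x))).re = ‖Q x‖ ^ 2 * (‖Q x‖⁻¹ * (‖Q x‖⁻¹ * (inner ℂ (Q x) (C (Q x))).re)) := by
            field_simp
          rw [h6, mul_comm s]
          exact mul_le_mul_of_nonneg_left h4.le h5.le
        have h4 : ‖Q x‖ ≤ ‖x‖ := Submodule.norm_starProjection_apply_le _ _
        rw [ContinuousLinearMap.rayleighQuotient, h1, abs_div, abs_of_nonneg h2, abs_of_nonneg (by positivity)]
        refine div_le_of_le_mul₀ (by positivity) hs0 (h3.trans ?_)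
        gcongr
      have hrP : LinearMap.rank (P : H →ₗ[ℂ] H) ≤ j := by
        have h1 : LinearMap.range (P : H →ₗ[ℂ] H) ≤ U := by
          rintro _ ⟨x, rfl⟩
          exact Submodule.starProjection_apply_mem _ _
        refine (Submodule.rank_mono h1).trans ?_
        rw [← Module.finrank_eq_rank]
        exact_mod_cast hfr
      have hF : LinearMap.rank ((C - G : H →L[ℂ] H) : H →ₗ[ℂ] H) < ((2 * k : ℕ) : Cardinal) := by
        have h1 : ((C - G : H →L[ℂ] H) : H →ₗ[ℂ] H) = (P : H →ₗ[ℂ] H) ∘ₗ (C : H →ₗ[ℂ] H)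
            + ((Q : H →ₗ[ℂ] H) ∘ₗ (C : H →ₗ[ℂ] H)) ∘ₗ (P : H →ₗ[ℂ] H) := by
          ext x
          change C x - Q (C (Q x)) = P (C x) + Q (C (P x))
          have e1 := hPQ (C x)
          have e2 : Q (C x) = Q (C (P x)) + Q (C (Q x)) := by
            rw [← map_add, ← map_add, ← hPQ x]
          rw [sub_eq_iff_eq_add, add_assoc, ← e2, ← e1]
        rw [h1]
        refine lt_of_le_of_lt (LinearMap.rank_add_le _ _) ?_
        refine lt_of_le_of_lt (add_le_add ((LinearMap.rank_comp_le_left _ _).trans hrP)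
          ((LinearMap.rank_comp_le_right _ _).trans hrP)) ?_
        have : j + j < 2 * k := by omega
        exact_mod_cast this
      have := sNum_le_of_rank C (C - G) (2 * k) hF
      rw [sub_sub_cancel] at this
      linarith
    refine ⟨Fin.cons w f, ?_, ?_⟩
    · have hwf : ∀ i, inner ℂ (f i) w = 0 := fun i =>
        (Submodule.mem_orthogonal _ _).1 hwU _ (Submodule.subset_span ⟨i, rfl⟩)
      rw [orthonormal_iff_ite] at hf ⊢
      intro a b
      refine Fin.cases ?_ (fun a => ?_) a <;> refine Fin.cases ?_ (fun b => ?_) b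
      · simp [hw1]
      · simp [inner_eq_zero_symm.1 (hwf b), (Fin.succ_ne_zero _).symm]
      · simp [hwf a]
      · have := hf a b
        simpa using this
    · intro i
      refine Fin.cases ?_ (fun i => ?_) i
      · simpa using hws
      · simpa using hfs i

end SNum

theorem slow_lower {b : ℝ} {L : ℝ → ℝ} (hL : SlowlyVarying b L) (p : ℕ) (hp : 0 < p) :
    ∃ c x₀ : ℝ, 0 < c ∧ b ≤ x₀ ∧ ∀ x, x₀ ≤ x → c ≤ x * L x ^ (2 * p) := by
  have hev := hL.slow.eventually (lt_mem_nhds (show -(1 / (2 * p : ℝ)) < 0 by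
    have : (0:ℝ) < p := by exact_mod_cast hp
    rw [neg_lt_zero]; positivity))
  obtain ⟨x₁, hx₁⟩ := eventually_atTop.1 hev
  set x₀ := max x₁ (b + 1) with hx₀
  have hb := hL.b_pos
  have hx₀b : b + 1 ≤ x₀ := le_max_right _ _
  have hd : ∀ x, b < x → HasDerivAt L (deriv L x) x := by
    intro x hx
    have h1 : ContDiffAt ℝ 1 L x := hL.contDiff.contDiffAt (Ici_mem_nhds hx)
    exact (h1.differentiableAt (by norm_num)).hasDerivAt
  have hg : ∀ x, b < x → HasDerivAt (fun x => x * L x ^ (2 * p))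
      (1 * L x ^ (2 * p) + x * (((2 * p : ℕ) : ℝ) * L x ^ (2 * p - 1) * deriv L x)) x := by
    intro x hx
    exact (hasDerivAt_id x).mul ((hd x hx).pow (2 * p))
  have hmono : MonotoneOn (fun x => x * L x ^ (2 * p)) (Set.Ici x₀) := by
    refine monotoneOn_of_deriv_nonneg (convex_Ici _) ?_ ?_ ?_
    · intro x hx
      exact (hg x (by have : x₀ ≤ x := hx; linarith)).continuousAt.continuousWithinAt
    · intro x hx
      rw [interior_Ici] at hx
      exact (hg x (by have : x₀ < x := hx; linarith)).differentiableAt.differentiableWithinAt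
    · intro x hx
      rw [interior_Ici] at hx
      have hx' : x₀ < x := hx
      rw [(hg x (by linarith)).deriv]
      have hLx := hL.pos x (by linarith)
      have h1 := hx₁ x ((le_max_left _ _).trans hx'.le)
      have hp' : (0:ℝ) < 2 * p := by have : (0:ℝ) < p := by exact_mod_cast hp
                                     positivity
      have e : L x ^ (2 * p) = L x ^ (2 * p - 1) * L x := by
        rw [← pow_succ]; congr 1; omega
      have h2 : 0 ≤ 1 + 2 * p * (x * deriv L x / L x) := by
        have := mul_lt_mul_of_pos_left h1 hp'
        have e2 : (2 * p : ℝ) * -(1 / (2 * p : ℝ)) = -1 := by field_simp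
        rw [e2] at this
        linarith
      have h3 : 1 * L x ^ (2 * p) + x * (((2 * p : ℕ) : ℝ) * L x ^ (2 * p - 1) * deriv L x)
          = L x ^ (2 * p) * (1 + 2 * p * (x * deriv L x / L x)) := by
        rw [e]; push_cast; field_simp
      rw [h3]
      positivity
  refine ⟨x₀ * L x₀ ^ (2 * p), x₀, ?_, by linarith, ?_⟩
  · have := hL.pos x₀ (by linarith)
    have : 0 < x₀ := by linarith
    positivity
  · intro x hx
    exact hmono (Set.mem_Ici.2 le_rfl) (Set.mem_Ici.2 hx) hx

/-- **Theorem 2.3.** If `A = C + T` is compact, `C` non-negative compact with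
`s n (C) / L n → a` for a slowly varying `L` and `0 < a < ∞`, and `T ∈ S_q` for some
`q > 0`, then the adjoint `A^*` cannot be Volterra, i.e. `A^*` has a nonzero eigenvalue. -/
theorem statement3 {H : Type*} [NormedAddCommGroup H] [InnerProductSpace ℂ H]
    [CompleteSpace H] (A C T : H →L[ℂ] H) (hA : A = C + T)
    (hAcompact : IsCompactOperator (⇑A))
    (hCcompact : IsCompactOperator (⇑C)) (hCpos : C.IsPositive)
    (hTcompact : IsCompactOperator (⇑T))
    (b : ℝ) (L : ℝ → ℝ) (hL : SlowlyVarying b L)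
    (a q : ℝ) (ha0 : 0 < a) (hq0 : 0 < q)
    (hC : Tendsto (fun n : ℕ => sNum C n / L n) atTop (𝓝 a))
    (hT : Summable (fun n : ℕ => sNum T (n + 1) ^ q)) :
    ∃ μ : ℂ, μ ≠ 0 ∧ Module.End.HasEigenvalue (ContinuousLinearMap.adjoint A : H →ₗ[ℂ] H) μ := by
  by_contra hno
  obtain ⟨k, M, hM0, hM⟩ := schatten_diag T q hq0 hT
  obtain ⟨K, hK0, hK⟩ := hilb_main k
  set p := 2 ^ (k + 1) with hp
  have hp0 : 0 < p := by positivity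
  have hAT : ∀ x, inner ℂ x (A x) = inner ℂ x (C x) + inner ℂ x (T x) := by
    intro x; rw [hA, add_apply, inner_add_right]
  have hCim : ∀ x, (inner ℂ x (C x)).im = 0 := by
    intro x; exact hCpos.isSymmetric.im_inner_self_apply x
  have hmain := hK H A hAcompact hno M (by
    intro n z hz
    refine le_trans (Finset.sum_le_sum fun i _ => ?_) (hM n z hz)
    rw [hAT, Complex.add_im, hCim, zero_add]
    exact pow_le_pow_left₀ (abs_nonneg _) (Complex.abs_im_le_norm _) _)
  have hbound : ∀ n : ℕ, 0 < sNum C (2 * n) → n * (sNum C (2 * n) / 4) ^ p ≤ 2 ^ p * (K * M + M) := by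
    intro n hn
    set s := sNum C (2 * n) / 2 with hs
    have hs0 : 0 < s := by positivity
    obtain ⟨f, hf, hfs⟩ := lower_family C hCpos n s hs0.le (by linarith) n le_rfl
    obtain ⟨x, hx1, hx2⟩ := hmain n f hf (s / 2) (by positivity)
    have h1 : ∀ i, sNum C (2 * n) / 4 ≤ |x i| + ‖inner ℂ (f i) (T (f i))‖ := by
      intro i
      have e1 := hfs i
      have e2 := hx2 i
      rw [hAT, Complex.add_re] at e2
      have e3 := (abs_le.1 (Complex.abs_re_le_norm (inner ℂ (f i) (T (f i))))).1
      have e4 := le_abs_self ((inner ℂ (f i) (C (f i))).re + (inner ℂ (f i) (T (f i))).re)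
      linarith
    calc n * (sNum C (2 * n) / 4) ^ p = ∑ i : Fin n, (sNum C (2 * n) / 4) ^ p := by simp
      _ ≤ ∑ i : Fin n, 2 ^ p * (|x i| ^ p + ‖inner ℂ (f i) (T (f i))‖ ^ p) := by
          refine Finset.sum_le_sum fun i _ => ?_
          refine (pow_le_pow_left₀ (by positivity) (h1 i) p).trans ?_
          refine (add_pow_le (abs_nonneg _) (norm_nonneg _) p).trans ?_
          gcongr
          · norm_num
          · exact Nat.sub_le _ _
      _ = 2 ^ p * (∑ i, |x i| ^ p + ∑ i, ‖inner ℂ (f i) (T (f i))‖ ^ p) := by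
          rw [← Finset.mul_sum, Finset.sum_add_distrib]
      _ ≤ _ := by gcongr; exact hM n f hf
  obtain ⟨c, x₀, hc0, hbx, hc⟩ := slow_lower hL p hp0
  set D : ℝ := 2 ^ p * (K * M + M) with hD
  have hD0 : 0 ≤ D := by positivity
  have hev := hC.eventually (lt_mem_nhds (half_lt_self ha0))
  obtain ⟨n₀, hn₀⟩ := eventually_atTop.1 hev
  set c₁ : ℝ := (a / 2) ^ (2 * p) * c with hc₁
  have hc₁0 : 0 < c₁ := by positivity
  obtain ⟨n, hn⟩ := exists_nat_gt (max (max x₀ n₀) ((2 * 4 ^ p * D) ^ 2 / c₁))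
  have hnx : x₀ < n := (le_max_left _ _).trans_lt ((le_max_left _ _).trans_lt hn)
  have hnn : (n₀ : ℝ) < n := (le_max_right _ _).trans_lt ((le_max_left _ _).trans_lt hn)
  have hnD : (2 * 4 ^ p * D) ^ 2 / c₁ < n := (le_max_right _ _).trans_lt hn
  have hb0 := hL.b_pos
  have hn0 : (0:ℝ) < n := by linarith
  set N : ℝ := ((2 * n : ℕ) : ℝ) with hN
  have hN2 : N = 2 * n := by rw [hN]; push_cast; ring
  have hLN : 0 < L N := hL.pos N (by linarith)
  have h1 : a / 2 < sNum C (2 * n) / L N :=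
    hn₀ (2 * n) (by have : n₀ < n := by exact_mod_cast hnn
                    omega)
  rw [lt_div_iff₀ hLN] at h1
  have hs0 : 0 < sNum C (2 * n) := lt_trans (by positivity) h1
  have h2 := hbound n hs0
  have h3 : c₁ ≤ N * sNum C (2 * n) ^ (2 * p) := by
    calc c₁ ≤ (a / 2) ^ (2 * p) * (N * L N ^ (2 * p)) := by
          rw [hc₁]; gcongr; exact hc N (by linarith)
      _ = N * (a / 2 * L N) ^ (2 * p) := by rw [mul_pow]; ring
      _ ≤ _ := by gcongr
  have h4 : N * sNum C (2 * n) ^ p ≤ 2 * 4 ^ p * D := by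
    rw [div_pow] at h2
    have h5 : N * sNum C (2 * n) ^ p = 2 * 4 ^ p * (n * (sNum C (2 * n) ^ p / 4 ^ p)) := by
      rw [hN2]; field_simp
    rw [h5]
    gcongr
  have h5 : N * c₁ ≤ (2 * 4 ^ p * D) ^ 2 := by
    calc N * c₁ ≤ N * (N * sNum C (2 * n) ^ (2 * p)) := by gcongr
      _ = (N * sNum C (2 * n) ^ p) ^ 2 := by ring
      _ ≤ _ := by gcongr
  rw [div_lt_iff₀ hc₁0] at hnD
  nlinarith
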